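/- arXiv:1310.1417 — 2 statements merged into one kernel-verified Lean document; each statement's English description precedes it below -/
import Mathlib

section
/- Let p_1 ≥ 3 be odd, let p_2 be an even positive integer dividing 2p_1, and let p_3 ≥ 2 be even. Then Γ(p_1, p_2, p_3), with its generating involutions x_0, x_1, x_2, x_3, satisfies the intersection condition; the elements x_0x_1, x_1x_2, x_2x_3 have orders exactly p_1, p_2, p_3 respectively; the order of Γ(p_1, p_2, p_3) equals 2 p_1 p_2 p_3; and the subgroup generated by x_0x_1, x_1x_2, x_2x_3 has index 2. -/
/-- The intersection condition for a group generated by `n` involutions. -/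
def interCond {G : Type*} [Group G] {n : ℕ} (ρ : Fin n → G) : Prop :=
  ∀ I J : Set (Fin n),
    Subgroup.closure (ρ '' I) ⊓ Subgroup.closure (ρ '' J) = Subgroup.closure (ρ '' (I ∩ J))

/-- The defining relations of the group `Γ(p_1, …, p_{n-1})`: the generators `x_0, …, x_{n-1}`
are involutions, `(x_{i-1} x_i)^{p_i} = 1`, `(x_i x_j)^2 = 1` for `|i - j| ≥ 2`, together with
the extra relators `r_i` (depending on the parities of `p_i` and `p_{i+1}`). -/
def gammaRels (n : ℕ) (p : ℕ → ℕ) : Set (FreeGroup (Fin n)) :=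
  {w | (∃ i : Fin n, w = (FreeGroup.of i) ^ 2)
     ∨ (∃ i j : Fin n, (i : ℕ) + 1 = (j : ℕ) ∧
          w = (FreeGroup.of i * FreeGroup.of j) ^ (p (j : ℕ)))
     ∨ (∃ i j : Fin n, (i : ℕ) + 2 ≤ (j : ℕ) ∧
          w = (FreeGroup.of i * FreeGroup.of j) ^ 2)
     ∨ (∃ a b c : Fin n, (a : ℕ) + 1 = (b : ℕ) ∧ (b : ℕ) + 1 = (c : ℕ) ∧
         ((Even (p (b : ℕ)) ∧ Even (p (c : ℕ)) ∧
             w = (FreeGroup.of a * FreeGroup.of b * FreeGroup.of c * FreeGroup.of b) ^ 2)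
        ∨ (Odd (p (b : ℕ)) ∧ Even (p (c : ℕ)) ∧
             w = (FreeGroup.of a * FreeGroup.of b * FreeGroup.of c * FreeGroup.of b *
                  FreeGroup.of c) ^ 2)
        ∨ (Even (p (b : ℕ)) ∧ Odd (p (c : ℕ)) ∧
             w = (FreeGroup.of c * FreeGroup.of b * FreeGroup.of a * FreeGroup.of b *
                  FreeGroup.of a) ^ 2)))}

/-- The group `Γ(p_1, …, p_{n-1})`. -/
abbrev Gamma (n : ℕ) (p : ℕ → ℕ) : Type := PresentedGroup (gammaRels n p)

/-- The generator `x_i` of `Γ(p_1, …, p_{n-1})`. -/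
def xg (n : ℕ) (p : ℕ → ℕ) (i : Fin n) : Gamma n p := PresentedGroup.of i

/-- The function recording the tuple `(p_1, p_2, p_3)` (indexed so that `pfun3 p1 p2 p3 i = p_i`). -/
def pfun3 (p1 p2 p3 : ℕ) : ℕ → ℕ :=
  fun i => if i = 1 then p1 else if i = 2 then p2 else if i = 3 then p3 else 2

section DihedralLift

variable {G : Type*} [Group G]

theorem zpow_zmod_cast {n : ℕ} {w : G} (h : w ^ n = 1) (z : ℤ) :
    w ^ (((z : ZMod n)).cast : ℤ) = w ^ z := by
  have hz : w ^ (n : ℤ) = 1 := by simpa using h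
  rw [ZMod.coe_intCast]
  conv_rhs => rw [← Int.emod_add_mul_ediv z n, zpow_add, zpow_mul, hz, one_zpow, mul_one]

theorem involution_mul_zpow {a w : G} (ha : a * a = 1) (h : a * w * a = w⁻¹) (k : ℤ) :
    a * w ^ k = w ^ (-k) * a := by
  have hs : SemiconjBy a w w⁻¹ := by
    unfold SemiconjBy
    rw [← h, mul_assoc, ha, mul_one]
  simpa using (hs.zpow_right k).eq

/-- The homomorphism from a dihedral group sending the reflections `sr 0`, `sr 1` to two given
involutions `a`, `b`. -/
def dihedralLift (n : ℕ) (a b : G) (ha : a * a = 1) (hb : b * b = 1) (hab : (a * b) ^ n = 1) :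
    DihedralGroup n →* G :=
  have hinv : a * (a * b) * a = (a * b)⁻¹ := by
    rw [mul_inv_rev, inv_eq_of_mul_eq_one_right ha, inv_eq_of_mul_eq_one_right hb,
      ← mul_assoc, ha, one_mul]
  MonoidHom.mk'
    (fun
      | .r i => (a * b) ^ (i.cast : ℤ)
      | .sr i => a * (a * b) ^ (i.cast : ℤ)) <| by
    rintro (i | i) (j | j) <;>
    obtain ⟨i, rfl⟩ := ZMod.intCast_surjective i <;>
    obtain ⟨j, rfl⟩ := ZMod.intCast_surjective j
    · simp only [DihedralGroup.r_mul_r, ← Int.cast_add, zpow_zmod_cast hab, zpow_add]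
    · simp only [DihedralGroup.r_mul_sr, ← Int.cast_sub, zpow_zmod_cast hab]
      rw [← mul_assoc, ← neg_neg i, ← involution_mul_zpow ha hinv, mul_assoc, ← zpow_add]
      congr 2; ring
    · simp only [DihedralGroup.sr_mul_r, ← Int.cast_add, zpow_zmod_cast hab, zpow_add, mul_assoc]
    · simp only [DihedralGroup.sr_mul_sr, ← Int.cast_sub, zpow_zmod_cast hab]
      rw [← mul_assoc, involution_mul_zpow ha hinv, mul_assoc (_ ^ _), ha, mul_one, ← zpow_add]
      congr 1; ring

variable {n : ℕ} {a b : G} (ha : a * a = 1) (hb : b * b = 1) (hab : (a * b) ^ n = 1)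

theorem dihedralLift_r (z : ℤ) :
    dihedralLift n a b ha hb hab (.r (z : ZMod n)) = (a * b) ^ z :=
  zpow_zmod_cast hab z

theorem dihedralLift_sr (z : ℤ) :
    dihedralLift n a b ha hb hab (.sr (z : ZMod n)) = a * (a * b) ^ z :=
  congrArg (a * ·) (zpow_zmod_cast hab z)

theorem dihedralLift_sr_zero : dihedralLift n a b ha hb hab (.sr 0) = a := by
  simpa using dihedralLift_sr ha hb hab 0

theorem dihedralLift_sr_one : dihedralLift n a b ha hb hab (.sr 1) = b := by
  have h := dihedralLift_sr ha hb hab 1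
  rwa [Int.cast_one, zpow_one, ← mul_assoc, ha, one_mul] at h

theorem dihedralHom_ext {f g : DihedralGroup n →* G} (h0 : f (.sr 0) = g (.sr 0))
    (h1 : f (.sr 1) = g (.sr 1)) : f = g := by
  have hr : ∀ z : ℤ, f (.r (z : ZMod n)) = g (.r (z : ZMod n)) := by
    intro z
    have : (.r (z : ZMod n) : DihedralGroup n) = (.sr 0 * .sr 1) ^ z := by simp
    rw [this, map_zpow, map_zpow, map_mul, map_mul, h0, h1]
  ext y
  rcases y with i | i <;> obtain ⟨i, rfl⟩ := ZMod.intCast_surjective i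
  · exact hr i
  · have : (.sr (i : ZMod n) : DihedralGroup n) = .sr 0 * .r (i : ZMod n) := by simp
    rw [this, map_mul, map_mul, h0, hr]

theorem dihedralLift_mem {H : Subgroup G} (h0 : a ∈ H) (h1 : b ∈ H) (y : DihedralGroup n) :
    dihedralLift n a b ha hb hab y ∈ H := by
  rcases y with i | i <;> obtain ⟨i, rfl⟩ := ZMod.intCast_surjective i
  · rw [dihedralLift_r]
    exact zpow_mem (mul_mem h0 h1) i
  · rw [dihedralLift_sr]
    exact mul_mem h0 (zpow_mem (mul_mem h0 h1) i)

theorem mem_zpowers_of_mul_self {y : G} (ha : a * a = 1) (h : y ∈ Subgroup.zpowers a) :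
    y = 1 ∨ y = a := by
  obtain ⟨k, rfl⟩ := Subgroup.mem_zpowers_iff.1 h
  rcases Int.even_or_odd' k with ⟨l, rfl | rfl⟩
  · left
    rw [zpow_mul, zpow_two, ha, one_zpow]
  · right
    rw [zpow_add, zpow_mul, zpow_two, ha, one_zpow, one_mul, zpow_one]

theorem dihedralLift_mem_of_mem_zpowers (hn : 2 ≤ n) {H : Subgroup G} {y : DihedralGroup n}
    (h0 : a ∉ H → y ∈ Subgroup.zpowers (.sr 1)) (h1 : b ∉ H → y ∈ Subgroup.zpowers (.sr 0)) :
    dihedralLift n a b ha hb hab y ∈ H := by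
  have : Fact (1 < n) := ⟨hn⟩
  by_cases h0H : a ∈ H
  · by_cases h1H : b ∈ H
    · exact dihedralLift_mem ha hb hab h0H h1H y
    · rcases mem_zpowers_of_mul_self (DihedralGroup.sr_mul_self _) (h1 h1H) with rfl | rfl
      · simp
      · rwa [dihedralLift_sr_zero]
  · rcases mem_zpowers_of_mul_self (DihedralGroup.sr_mul_self _) (h0 h0H) with rfl | rfl
    · simp
    · by_cases h1H : b ∈ H
      · rwa [dihedralLift_sr_one]
      · rcases mem_zpowers_of_mul_self (DihedralGroup.sr_mul_self _) (h1 h1H) with h | h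
        · exact absurd h (fun h => DihedralGroup.noConfusion rfl (heq_of_eq h))
        · simp at h

end DihedralLift

/-- The defining relations of `Γ(p, 2q, m)` for `p` odd and `m` even. -/
structure GammaRelations {G : Type*} [Group G] (p q m : ℕ) (x : Fin 4 → G) : Prop where
  mul_self : ∀ i, x i * x i = 1
  pow01 : (x 0 * x 1) ^ p = 1
  pow12 : (x 1 * x 2) ^ (2 * q) = 1
  pow23 : (x 2 * x 3) ^ m = 1
  comm02 : x 0 * x 2 = x 2 * x 0
  comm03 : x 0 * x 3 = x 3 * x 0
  comm13 : x 1 * x 3 = x 3 * x 1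
  rel012 : (x 0 * x 1 * x 2 * x 1 * x 2) ^ 2 = 1
  rel123 : (x 1 * x 2 * x 3 * x 2) ^ 2 = 1

namespace GammaRelations

variable {G : Type*} [Group G] {p q m : ℕ} {x : Fin 4 → G} (h : GammaRelations p q m x)

include h

theorem inv_eq (i : Fin 4) : (x i)⁻¹ = x i := inv_eq_of_mul_eq_one_right (h.mul_self i)

theorem cancel (i : Fin 4) (g : G) : x i * (x i * g) = g := by
  rw [← mul_assoc, h.mul_self, one_mul]

theorem conj_zero : x 0 * (x 1 * x 2) ^ 2 * x 0 = ((x 1 * x 2) ^ 2)⁻¹ := by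
  rw [eq_inv_iff_mul_eq_one]
  have := h.rel012
  simpa only [pow_two, mul_assoc] using this

theorem conj_one : x 1 * (x 1 * x 2) ^ 2 * x 1 = ((x 1 * x 2) ^ 2)⁻¹ := by
  simp only [pow_two, mul_assoc, mul_inv_rev, h.inv_eq, h.cancel]

theorem conj_two : x 2 * (x 1 * x 2) ^ 2 * x 2 = ((x 1 * x 2) ^ 2)⁻¹ := by
  simp only [pow_two, mul_assoc, mul_inv_rev, h.inv_eq, h.mul_self, mul_one]

theorem commute_three : Commute (x 3) ((x 1 * x 2) ^ 2) := by
  have h1 : Commute (x 3) (x 1) := h.comm13.symm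
  have h2 : Commute (x 3) (x 2 * x 1 * x 2) := by
    have := h.rel123
    rw [pow_two, mul_eq_one_iff_eq_inv] at this
    simp only [mul_inv_rev, h.inv_eq, mul_assoc] at this
    have := congrArg (fun g => x 2 * g) this
    simp only [h.cancel] at this
    have := congrArg (fun g => g * x 2) this
    simpa only [mul_assoc, h.mul_self, mul_one, Commute, SemiconjBy] using this.symm
  have := h1.mul_right h2
  simpa only [pow_two, mul_assoc] using this

theorem zero_mul_zpow (k : ℤ) :
    x 0 * ((x 1 * x 2) ^ 2) ^ k = ((x 1 * x 2) ^ 2) ^ (-k) * x 0 :=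
  involution_mul_zpow (h.mul_self 0) h.conj_zero k

theorem one_mul_zpow (k : ℤ) :
    x 1 * ((x 1 * x 2) ^ 2) ^ k = ((x 1 * x 2) ^ 2) ^ (-k) * x 1 :=
  involution_mul_zpow (h.mul_self 1) h.conj_one k

theorem two_mul_zpow (k : ℤ) :
    x 2 * ((x 1 * x 2) ^ 2) ^ k = ((x 1 * x 2) ^ 2) ^ (-k) * x 2 :=
  involution_mul_zpow (h.mul_self 2) h.conj_two k

theorem two_mul_rotation_zpow (k : ℤ) :
    x 2 * (x 0 * x 1) ^ k = ((x 1 * x 2) ^ 2) ^ k * (x 0 * x 1) ^ k * x 2 := by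
  have hc : Commute ((x 1 * x 2) ^ 2) (x 0 * x 1) := by
    have h0 := h.zero_mul_zpow (-1)
    have h1 := h.one_mul_zpow 1
    simp only [zpow_neg, zpow_one, inv_inv] at h0 h1
    rw [Commute, SemiconjBy, ← mul_assoc, ← h0, mul_assoc, mul_assoc, h1]
  have hs : SemiconjBy (x 2) (x 0 * x 1) ((x 1 * x 2) ^ 2 * (x 0 * x 1)) := by
    rw [SemiconjBy, hc.eq]
    simp only [pow_two, mul_assoc, h.cancel, h.mul_self, mul_one]
    rw [← mul_assoc, ← mul_assoc, h.comm02]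
  rw [(hs.zpow_right k).eq, hc.mul_zpow]

/-- The homomorphism from a dihedral group onto `⟨x 0, x 1⟩`. -/
def lift01 : DihedralGroup p →* G :=
  dihedralLift p (x 0) (x 1) (h.mul_self 0) (h.mul_self 1) h.pow01

/-- The homomorphism from a dihedral group onto `⟨x 2, x 3⟩`. -/
def lift23 : DihedralGroup m →* G :=
  dihedralLift m (x 2) (x 3) (h.mul_self 2) (h.mul_self 3) h.pow23

theorem two_mul_lift01 (y : DihedralGroup p) :
    ∃ l : ℤ, x 2 * h.lift01 y = ((x 1 * x 2) ^ 2) ^ l * h.lift01 y * x 2 := by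
  rcases y with i | i <;> obtain ⟨i, rfl⟩ := ZMod.intCast_surjective i
  · exact ⟨i, by rw [lift01, dihedralLift_r, h.two_mul_rotation_zpow]⟩
  · refine ⟨-i, ?_⟩
    rw [lift01, dihedralLift_sr, ← mul_assoc, ← h.comm02, mul_assoc, h.two_mul_rotation_zpow,
      ← mul_assoc, ← mul_assoc, h.zero_mul_zpow]
    simp only [mul_assoc]

theorem commute_three_lift01 (y : DihedralGroup p) : Commute (x 3) (h.lift01 y) := by
  have hy : h.lift01 y ∈ Subgroup.centralizer {x 3} :=
    dihedralLift_mem _ _ _ (Subgroup.mem_centralizer_singleton_iff.2 h.comm03)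
      (Subgroup.mem_centralizer_singleton_iff.2 h.comm13) y
  exact (Subgroup.mem_centralizer_singleton_iff.1 hy).symm

theorem exists_normal_form (hx : Subgroup.closure (Set.range x) = ⊤) (g : G) :
    ∃ (k : ℤ) (y : DihedralGroup p) (d : DihedralGroup m),
      g = ((x 1 * x 2) ^ 2) ^ k * h.lift01 y * h.lift23 d := by
  have h0 : x 0 = h.lift01 (.sr 0) := (dihedralLift_sr_zero _ _ _).symm
  have h1 : x 1 = h.lift01 (.sr 1) := (dihedralLift_sr_one _ _ _).symm
  have h2 : x 2 = h.lift23 (.sr 0) := (dihedralLift_sr_zero _ _ _).symm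
  have h3 : x 3 = h.lift23 (.sr 1) := (dihedralLift_sr_one _ _ _).symm
  have step : ∀ i g, (∃ (k : ℤ) (y : DihedralGroup p) (d : DihedralGroup m),
      g = ((x 1 * x 2) ^ 2) ^ k * h.lift01 y * h.lift23 d) →
      ∃ (k : ℤ) (y : DihedralGroup p) (d : DihedralGroup m),
      x i * g = ((x 1 * x 2) ^ 2) ^ k * h.lift01 y * h.lift23 d := by
    rintro i _ ⟨k, y, d, rfl⟩
    fin_cases i
    · refine ⟨-k, .sr 0 * y, d, ?_⟩
      rw [map_mul, ← h0]
      simp only [Fin.zero_eta, ← mul_assoc, h.zero_mul_zpow]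
    · refine ⟨-k, .sr 1 * y, d, ?_⟩
      rw [map_mul, ← h1]
      simp only [Fin.mk_one, ← mul_assoc, h.one_mul_zpow]
    · obtain ⟨l, hl⟩ := h.two_mul_lift01 y
      refine ⟨-k + l, y, .sr 0 * d, ?_⟩
      rw [map_mul, ← h2, zpow_add]
      simp only [Fin.reduceFinMk, ← mul_assoc, h.two_mul_zpow]
      rw [mul_assoc (_ ^ (-k)) (x 2), hl]
      simp only [mul_assoc]
    · refine ⟨k, y, .sr 1 * d, ?_⟩
      rw [map_mul, ← h3]
      simp only [Fin.reduceFinMk, ← mul_assoc, (h.commute_three.zpow_right k).eq]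
      rw [mul_assoc (_ ^ k), (h.commute_three_lift01 y).eq]
      simp only [mul_assoc]
  have hg : g ∈ Subgroup.closure (Set.range x) := hx ▸ Subgroup.mem_top g
  induction hg using Subgroup.closure_induction_left with
  | one => exact ⟨0, 1, 1, by simp⟩
  | mul_left a ha g _ ih =>
    obtain ⟨i, rfl⟩ := ha
    exact step i g ih
  | inv_mul_cancel a ha g _ ih =>
    obtain ⟨i, rfl⟩ := ha
    rw [h.inv_eq]
    exact step i g ih

end GammaRelations

theorem gammaRelations_xg {p q m : ℕ} (hp : Odd p) (hm : Even m) :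
    GammaRelations p q m (xg 4 (pfun3 p (2 * q) m)) := by
  have key : ∀ w ∈ gammaRels 4 (pfun3 p (2 * q) m),
      PresentedGroup.mk (gammaRels 4 (pfun3 p (2 * q) m)) w = 1 :=
    fun w hw => PresentedGroup.one_of_mem hw
  have hsq : ∀ i, xg 4 (pfun3 p (2 * q) m) i * xg 4 (pfun3 p (2 * q) m) i = 1 := fun i => by
    have := key _ (Or.inl ⟨i, rfl⟩)
    rwa [map_pow, pow_two] at this
  have hpow : ∀ i j : Fin 4, (i : ℕ) + 1 = j →
      (xg 4 (pfun3 p (2 * q) m) i * xg 4 (pfun3 p (2 * q) m) j) ^ pfun3 p (2 * q) m j = 1 :=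
    fun i j hij => by
      have := key _ (Or.inr (Or.inl ⟨i, j, hij, rfl⟩))
      rwa [map_pow, map_mul] at this
  have hcomm : ∀ i j : Fin 4, (i : ℕ) + 2 ≤ j →
      xg 4 (pfun3 p (2 * q) m) i * xg 4 (pfun3 p (2 * q) m) j =
        xg 4 (pfun3 p (2 * q) m) j * xg 4 (pfun3 p (2 * q) m) i :=
    fun i j hij => by
      have := key _ (Or.inr (Or.inr (Or.inl ⟨i, j, hij, rfl⟩)))
      rw [map_pow, map_mul, pow_two, mul_eq_one_iff_eq_inv, mul_inv_rev] at this
      change xg 4 _ i * xg 4 _ j = (xg 4 _ j)⁻¹ * (xg 4 _ i)⁻¹ at this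
      rwa [inv_eq_of_mul_eq_one_right (hsq i), inv_eq_of_mul_eq_one_right (hsq j)] at this
  refine ⟨hsq, hpow 0 1 rfl, hpow 1 2 rfl, hpow 2 3 rfl, hcomm 0 2 (by decide),
    hcomm 0 3 (by decide), hcomm 1 3 (by decide), ?_, ?_⟩
  · have := key _ (Or.inr (Or.inr (Or.inr ⟨0, 1, 2, rfl, rfl,
      Or.inr (Or.inl ⟨hp, even_two_mul q, rfl⟩)⟩)))
    rwa [map_pow, map_mul, map_mul, map_mul, map_mul] at this
  · have := key _ (Or.inr (Or.inr (Or.inr ⟨1, 2, 3, rfl, rfl,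
      Or.inl ⟨even_two_mul q, hm, rfl⟩⟩)))
    rwa [map_pow, map_mul, map_mul, map_mul] at this

theorem GammaRelations.exists_hom {G : Type*} [Group G] {p q m : ℕ} {x : Fin 4 → G}
    (h : GammaRelations p q m x) (hp : Odd p) (hm : Even m) :
    ∃ φ : Gamma 4 (pfun3 p (2 * q) m) →* G, ∀ i, φ (xg 4 (pfun3 p (2 * q) m) i) = x i := by
  have hp' : ¬ Even p := Nat.not_even_iff_odd.2 hp
  have hm' : ¬ Odd m := Nat.not_odd_iff_even.2 hm
  have hq' : ¬ Odd (2 * q) := Nat.not_odd_iff_even.2 (even_two_mul q)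
  refine ⟨PresentedGroup.toGroup (f := x) ?_, fun i => PresentedGroup.toGroup.of _⟩
  rintro w (⟨i, rfl⟩ | ⟨i, j, hij, rfl⟩ | ⟨i, j, hij, rfl⟩ | ⟨a, b, c, hab, hbc, hw⟩)
  · simp [pow_two, h.mul_self]
  · fin_cases i <;> fin_cases j <;> simp at hij <;> simp [pfun3, h.pow01, h.pow12, h.pow23]
  · have comm : ∀ i j, x i * x j = x j * x i → (x i * x j) ^ 2 = 1 := fun i j hc => by
      rw [pow_two, mul_assoc, hc, h.cancel, h.mul_self]
    fin_cases i <;> fin_cases j <;> simp at hij <;>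
      simp [comm _ _ h.comm02, comm _ _ h.comm03, comm _ _ h.comm13]
  · fin_cases a <;> fin_cases b <;> simp at hab <;> fin_cases c <;> simp at hbc
    · rcases hw with ⟨h1, -, rfl⟩ | ⟨-, -, rfl⟩ | ⟨h1, -, rfl⟩
      · exact absurd h1 hp'
      · simpa using h.rel012
      · exact absurd h1 hp'
    · rcases hw with ⟨-, -, rfl⟩ | ⟨h1, -, rfl⟩ | ⟨-, h1, rfl⟩
      · simpa using h.rel123
      · exact absurd h1 hq'
      · exact absurd h1 hm'

/-- The images of the generators of `Γ(p, 2q, m)` in a product of three dihedral groups. -/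
def dihedralModel (p q m : ℕ) :
    Fin 4 → DihedralGroup p × DihedralGroup q × DihedralGroup m :=
  ![(.sr 0, .sr 0, 1), (.sr 1, .sr 1, 1), (1, .sr 0, .sr 0), (1, 1, .sr 1)]

theorem gammaRelations_dihedralModel {p q m : ℕ} (hqp : q ∣ p) (hm : Even m) :
    GammaRelations p q m (dihedralModel p q m) := by
  have hq : ((p : ℕ) : ZMod q) = 0 := (ZMod.natCast_eq_zero_iff p q).2 hqp
  obtain ⟨l, rfl⟩ := hm
  have hl : (.sr 0 : DihedralGroup q) ^ (l + l) = 1 := by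
    rw [← two_mul, pow_mul, pow_two, DihedralGroup.sr_mul_self, one_pow]
  constructor
  · intro i
    fin_cases i <;> simp [dihedralModel]
  all_goals
    simp [dihedralModel, hl, Prod.ext_iff, pow_two, pow_mul, hq]

/-- The reduction from the first to the second factor of the dihedral model. -/
def dihedralReduction {p q : ℕ} (hqp : q ∣ p) : DihedralGroup p →* DihedralGroup q :=
  dihedralLift p (.sr 0) (.sr 1) (by simp) (by simp)
    (by simp [(ZMod.natCast_eq_zero_iff p q).2 hqp])

theorem gammaRelations_sign (p q m : ℕ) :
    GammaRelations p q m (fun _ : Fin 4 => (-1 : ℤˣ)) := by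
  constructor <;> simp

namespace GammaRelations

variable {G : Type*} [Group G] {p q m : ℕ} {x : Fin 4 → G} (h : GammaRelations p q m x)
  (hqp : q ∣ p) {φ : G →* DihedralGroup p × DihedralGroup q × DihedralGroup m}
  (hφ : ∀ i, φ (x i) = dihedralModel p q m i)

include hφ in
theorem map_zpow_commutator (k : ℤ) :
    φ (((x 1 * x 2) ^ 2) ^ k) = (1, .r (((-2 * k : ℤ) : ZMod q)), 1) := by
  simp only [map_zpow, map_pow, map_mul, hφ, Prod.ext_iff]
  simp [dihedralModel, pow_two]
  ring

include hφ in
theorem map_lift01 (y : DihedralGroup p) :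
    φ (h.lift01 y) = (y, dihedralReduction hqp y, 1) := by
  have : φ.comp h.lift01 = (MonoidHom.id _).prod ((dihedralReduction hqp).prod 1) := by
    apply dihedralHom_ext
    · simp [lift01, dihedralReduction, dihedralLift_sr_zero, hφ, dihedralModel]
    · simp [lift01, dihedralReduction, dihedralLift_sr_one, hφ, dihedralModel]
  exact DFunLike.congr_fun this y

include hφ in
theorem map_lift23 (d : DihedralGroup m) :
    ∃ b ∈ Subgroup.zpowers (.sr 0 : DihedralGroup q), φ (h.lift23 d) = (1, b, d) := by
  have h1 : (MonoidHom.fst _ _).comp (φ.comp h.lift23) = 1 := by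
    apply dihedralHom_ext
    · simp [lift23, dihedralLift_sr_zero, hφ, dihedralModel]
    · simp [lift23, dihedralLift_sr_one, hφ, dihedralModel]
  have h2 : (MonoidHom.snd _ _).comp ((MonoidHom.snd _ _).comp (φ.comp h.lift23)) =
      MonoidHom.id _ := by
    apply dihedralHom_ext
    · simp [lift23, dihedralLift_sr_zero, hφ, dihedralModel]
    · simp [lift23, dihedralLift_sr_one, hφ, dihedralModel]
  refine ⟨(φ (h.lift23 d)).2.1, ?_,
    Prod.ext (DFunLike.congr_fun h1 d) (Prod.ext rfl (DFunLike.congr_fun h2 d))⟩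
  have := dihedralLift_mem (h.mul_self 2) (h.mul_self 3) h.pow23
    (H := (Subgroup.zpowers (.sr 0 : DihedralGroup q)).comap
      ((MonoidHom.fst _ _).comp ((MonoidHom.snd _ _).comp φ)))
    (by simp [hφ, dihedralModel]) (by simp [hφ, dihedralModel, one_mem]) d
  exact this

include hφ in
theorem map_normal_form (d : DihedralGroup m) :
    ∃ b ∈ Subgroup.zpowers (.sr 0 : DihedralGroup q), ∀ (k : ℤ) (y : DihedralGroup p),
      φ (((x 1 * x 2) ^ 2) ^ k * h.lift01 y * h.lift23 d) =
        (y, .r (((-2 * k : ℤ) : ZMod q)) * dihedralReduction hqp y * b, d) := by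
  obtain ⟨b, hb, hd⟩ := h.map_lift23 hφ d
  refine ⟨b, hb, fun k y => ?_⟩
  rw [map_mul, map_mul, map_zpow_commutator hφ, h.map_lift01 hqp hφ, hd]
  simp

include h in
theorem zpow_commutator_eq_one (hq : Odd q) {k : ℤ}
    (hk : (.r ((-2 * k : ℤ) : ZMod q) : DihedralGroup q) ∈ Subgroup.zpowers (.sr 0)) :
    ((x 1 * x 2) ^ 2) ^ k = 1 := by
  rcases mem_zpowers_of_mul_self (DihedralGroup.sr_mul_self _) hk with hk | hk
  · rw [DihedralGroup.one_def, DihedralGroup.r.injEq, ZMod.intCast_zmod_eq_zero_iff_dvd] at hk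
    have hc : IsCoprime (q : ℤ) (-2) := by
      rw [IsCoprime.neg_right_iff]
      exact_mod_cast hq.coprime_two_right
    obtain ⟨l, rfl⟩ := hc.dvd_of_dvd_mul_left hk
    rw [zpow_mul, zpow_natCast, ← pow_mul, h.pow12, one_zpow]
  · simp at hk

variable (hx : Subgroup.closure (Set.range x) = ⊤)

include h hqp hφ hx

theorem injective (hq : Odd q) : Function.Injective φ := by
  rw [injective_iff_map_eq_one]
  intro g hg
  obtain ⟨k, y, d, rfl⟩ := h.exists_normal_form hx g
  obtain ⟨b, hb, hd⟩ := h.map_normal_form hqp hφ d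
  rw [hd] at hg
  simp only [Prod.ext_iff, Prod.fst_one, Prod.snd_one] at hg
  obtain ⟨rfl, hg, rfl⟩ := hg
  rw [map_one, mul_one, mul_eq_one_iff_eq_inv] at hg
  rw [h.zpow_commutator_eq_one hq (hg ▸ inv_mem hb)]
  simp

theorem natCard [NeZero q] (hq : Odd q) : Nat.card G = 2 * (p * (2 * q) * m) := by
  let F : ZMod q × DihedralGroup p × DihedralGroup m → G := fun a =>
    ((x 1 * x 2) ^ 2) ^ (a.1.cast : ℤ) * h.lift01 a.2.1 * h.lift23 a.2.2
  have hpow : ((x 1 * x 2) ^ 2) ^ q = 1 := by rw [← pow_mul, h.pow12]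
  have hF : Function.Bijective F := by
    constructor
    · rintro ⟨k, y, d⟩ ⟨k', y', d'⟩ heq
      obtain ⟨k, rfl⟩ := ZMod.intCast_surjective k
      obtain ⟨k', rfl⟩ := ZMod.intCast_surjective k'
      simp only [F, zpow_zmod_cast hpow] at heq
      have hφeq := congrArg φ heq
      obtain ⟨b, -, hd⟩ := h.map_normal_form hqp hφ d
      obtain ⟨b', -, hd'⟩ := h.map_normal_form hqp hφ d'
      rw [hd, hd'] at hφeq
      simp only [Prod.ext_iff] at hφeq
      obtain ⟨rfl, -, rfl⟩ := hφeq
      have heq := congrArg φ (mul_right_cancel (mul_right_cancel heq))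
      rw [map_zpow_commutator hφ, map_zpow_commutator hφ] at heq
      simp only [Prod.ext_iff, DihedralGroup.r.injEq, Int.cast_mul] at heq
      have h2 : IsUnit (2 : ZMod q) := by
        have := (ZMod.isUnit_iff_coprime 2 q).2 hq.coprime_two_left
        exact_mod_cast this
      have hk : (k : ZMod q) = k' := h2.mul_left_cancel (by simpa using heq.2.1)
      rw [hk]
    · intro g
      obtain ⟨k, y, d, rfl⟩ := h.exists_normal_form hx g
      exact ⟨(k, y, d), by simp only [F, zpow_zmod_cast hpow]⟩
  rw [← Nat.card_congr (Equiv.ofBijective F hF), Nat.card_prod, Nat.card_prod,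
    DihedralGroup.nat_card, DihedralGroup.nat_card, Nat.card_zmod]
  ring

theorem mem_closure_of_forall (hq : Odd q) (hp2 : 2 ≤ p) (hm2 : 2 ≤ m) {I : Set (Fin 4)} {g : G}
    (h0 : 0 ∉ I → (φ g).1 ∈ Subgroup.zpowers (.sr 1))
    (h1 : 1 ∉ I → (φ g).1 ∈ Subgroup.zpowers (.sr 0) ∧ (φ g).2.1 ∈ Subgroup.zpowers (.sr 0))
    (h2 : 2 ∉ I → (φ g).2.2 ∈ Subgroup.zpowers (.sr 1) ∧
      dihedralReduction hqp (φ g).1 = (φ g).2.1)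
    (h3 : 3 ∉ I → (φ g).2.2 ∈ Subgroup.zpowers (.sr 0)) :
    g ∈ Subgroup.closure (x '' I) := by
  have hgen : ∀ {i}, x i ∉ Subgroup.closure (x '' I) → i ∉ I := fun hi hiI =>
    hi (Subgroup.subset_closure (Set.mem_image_of_mem x hiI))
  obtain ⟨k, y, d, rfl⟩ := h.exists_normal_form hx g
  obtain ⟨b, hb, hd⟩ := h.map_normal_form hqp hφ d
  simp only [hd] at h0 h1 h2 h3
  refine mul_mem (mul_mem ?_ ?_) ?_
  · by_cases h1I : x 1 ∈ Subgroup.closure (x '' I)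
    · by_cases h2I : x 2 ∈ Subgroup.closure (x '' I)
      · exact zpow_mem (pow_mem (mul_mem h1I h2I) 2) k
      · obtain ⟨hd1, heq⟩ := h2 (hgen h2I)
        have hb1 : b = 1 := by
          have hb0 := congrArg (fun t => t.2.1) (hd 0 1)
          rcases mem_zpowers_of_mul_self (DihedralGroup.sr_mul_self _) hd1 with rfl | rfl
          · simpa using hb0.symm
          · simpa [lift23, dihedralLift_sr_one, hφ, dihedralModel] using hb0.symm
        rw [hb1, mul_one] at heq
        rw [h.zpow_commutator_eq_one hq (right_eq_mul.1 heq ▸ one_mem _)]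
        exact one_mem _
    · obtain ⟨hy, hyb⟩ := h1 (hgen h1I)
      have hred : dihedralReduction hqp y ∈ Subgroup.zpowers (.sr 0) := by
        rcases mem_zpowers_of_mul_self (DihedralGroup.sr_mul_self _) hy with rfl | rfl
        · simp [one_mem]
        · rw [dihedralReduction, dihedralLift_sr_zero]
          exact Subgroup.mem_zpowers _
      rw [mul_mem_cancel_right hb, mul_mem_cancel_right hred] at hyb
      rw [h.zpow_commutator_eq_one hq hyb]
      exact one_mem _
  · exact dihedralLift_mem_of_mem_zpowers _ _ _ hp2 (fun hi => h0 (hgen hi))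
      (fun hi => (h1 (hgen hi)).1)
  · exact dihedralLift_mem_of_mem_zpowers _ _ _ hm2 (fun hi => (h2 (hgen hi)).1)
      (fun hi => h3 (hgen hi))

theorem interCond_of_hom (hq : Odd q) (hp2 : 2 ≤ p) (hm2 : 2 ≤ m) : interCond x := by
  have hle : ∀ {i : Fin 4} {K : Subgroup (DihedralGroup p × DihedralGroup q × DihedralGroup m)},
      (∀ j, j ≠ i → dihedralModel p q m j ∈ K) →
      ∀ {I : Set (Fin 4)} {g : G}, g ∈ Subgroup.closure (x '' I) → i ∉ I → φ g ∈ K := by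
    intro i K hK I g hg hi
    have : Subgroup.closure (x '' I) ≤ K.comap φ := by
      rw [Subgroup.closure_le]
      rintro _ ⟨j, hj, rfl⟩
      change φ (x j) ∈ K
      rw [hφ]
      exact hK j (fun hji => hi (hji ▸ hj))
    exact this hg
  have hor : ∀ {P : Fin 4 → Prop} {I J : Set (Fin 4)}, (∀ i, i ∉ I → P i) → (∀ i, i ∉ J → P i) →
      ∀ i, i ∉ I ∩ J → P i := by
    intro P I J hI hJ i hi
    by_cases hiI : i ∈ I
    · exact hJ i fun hiJ => hi ⟨hiI, hiJ⟩
    · exact hI i hiI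
  let K : Fin 4 → Subgroup (DihedralGroup p × DihedralGroup q × DihedralGroup m) :=
    ![(Subgroup.zpowers (.sr 1)).prod ⊤,
      (Subgroup.zpowers (.sr 0)).prod ((Subgroup.zpowers (.sr 0)).prod ⊤),
      (Subgroup.prod ⊤ (Subgroup.prod ⊤ (Subgroup.zpowers (.sr 1)))) ⊓
        ((dihedralReduction hqp).comp (MonoidHom.fst _ _)).eqLocus
          ((MonoidHom.fst _ _).comp (MonoidHom.snd _ _)),
      Subgroup.prod ⊤ (Subgroup.prod ⊤ (Subgroup.zpowers (.sr 0)))]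
  have hK : ∀ i j, j ≠ i → dihedralModel p q m j ∈ K i := by
    intro i j hji
    fin_cases i <;> fin_cases j <;> first | exact absurd rfl hji | skip
    all_goals
      simp [K, dihedralModel, Subgroup.mem_prod, one_mem, MonoidHom.eqLocus, dihedralReduction,
        dihedralLift_sr_zero, dihedralLift_sr_one]
  intro I J
  refine le_antisymm (fun g hg => ?_) (le_inf (Subgroup.closure_mono (Set.image_mono
    Set.inter_subset_left)) (Subgroup.closure_mono (Set.image_mono Set.inter_subset_right)))
  have hg' : ∀ i, i ∉ I ∩ J → φ g ∈ K i :=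
    hor (fun i => hle (hK i) hg.1) (fun i => hle (hK i) hg.2)
  exact h.mem_closure_of_forall hqp hφ hx hq hp2 hm2
    (fun hi => (hg' 0 hi).1) (fun hi => ⟨(hg' 1 hi).1, (hg' 1 hi).2.1⟩)
    (fun hi => ⟨(hg' 2 hi).1.2.2, (hg' 2 hi).2⟩) (fun hi => (hg' 3 hi).2.2)

theorem orderOf_eq (hq : Odd q) (hm : Even m) :
    orderOf (x 0 * x 1) = p ∧ orderOf (x 1 * x 2) = 2 * q ∧ orderOf (x 2 * x 3) = m := by
  have hinj := h.injective hqp hφ hx hq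
  have hr : orderOf (.r (-1) : DihedralGroup q) = q := by
    rw [← DihedralGroup.inv_r, orderOf_inv, DihedralGroup.orderOf_r_one]
  refine ⟨?_, ?_, ?_⟩
  · rw [← orderOf_injective φ hinj, map_mul, hφ, hφ]
    simpa [dihedralModel, Prod.orderOf, DihedralGroup.orderOf_r_one] using Nat.lcm_eq_left hqp
  · rw [← orderOf_injective φ hinj, map_mul, hφ, hφ]
    simp only [dihedralModel, Prod.orderOf, Prod.mk_mul_mk, Matrix.cons_val, mul_one, one_mul,
      DihedralGroup.orderOf_sr, DihedralGroup.sr_mul_sr, zero_sub, hr]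
    rw [Nat.lcm_comm q, ← Nat.lcm_assoc, Nat.lcm_self, hq.coprime_two_left.lcm_eq_mul]
  · rw [← orderOf_injective φ hinj, map_mul, hφ, hφ]
    simpa [dihedralModel, Prod.orderOf, DihedralGroup.orderOf_r_one] using
      Nat.lcm_eq_right hm.two_dvd

end GammaRelations

theorem index_rotationSubgroup_eq_two {G : Type*} [Group G] {p q m : ℕ} {x : Fin 4 → G}
    (h : GammaRelations p q m x) (hx : Subgroup.closure (Set.range x) = ⊤) {ε : G →* ℤˣ}
    (hε : ∀ i, ε (x i) = -1) :
    (Subgroup.closure ({x 0 * x 1, x 1 * x 2, x 2 * x 3} : Set G)).index = 2 := by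
  set H := Subgroup.closure ({x 0 * x 1, x 1 * x 2, x 2 * x 3} : Set G) with hH
  have h01 : x 0 * x 1 ∈ H := Subgroup.subset_closure (by simp)
  have h12 : x 1 * x 2 ∈ H := Subgroup.subset_closure (by simp)
  have h23 : x 2 * x 3 ∈ H := Subgroup.subset_closure (by simp)
  have h02 : x 0 * x 2 ∈ H := by
    have := mul_mem h01 h12
    rwa [mul_assoc, h.cancel] at this
  have h03 : x 0 * x 3 ∈ H := by
    have := mul_mem h02 h23
    rwa [mul_assoc, h.cancel] at this
  have h0 : ∀ i, x 0 * x i ∈ H := by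
    intro i
    fin_cases i
    · simp [h.mul_self, one_mem]
    exacts [h01, h02, h03]
  have hker : H ≤ ε.ker := by
    rw [hH, Subgroup.closure_le]
    rintro _ (rfl | rfl | rfl) <;> simp [hε]
  rw [Subgroup.index_eq_two_iff']
  refine ⟨x 0, fun g => ?_⟩
  rw [xor_iff_or_and_not_and]
  refine ⟨?_, fun ⟨h1, h2⟩ => ?_⟩
  · have step : ∀ i g, x 0 * g ∈ H ∨ g ∈ H → x 0 * (x i * g) ∈ H ∨ x i * g ∈ H := by
      rintro i g (hg | hg)
      · right
        have := mul_mem (inv_mem (h0 i)) hg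
        rwa [mul_inv_rev, h.inv_eq, h.inv_eq, mul_assoc, h.cancel] at this
      · left
        rw [← mul_assoc]
        exact mul_mem (h0 i) hg
    have hg : g ∈ Subgroup.closure (Set.range x) := hx ▸ Subgroup.mem_top g
    induction hg using Subgroup.closure_induction_left with
    | one => exact Or.inr (one_mem _)
    | mul_left a ha g _ ih =>
      obtain ⟨i, rfl⟩ := ha
      exact step i g ih
    | inv_mul_cancel a ha g _ ih =>
      obtain ⟨i, rfl⟩ := ha
      rw [h.inv_eq]
      exact step i g ih
  · have h1 := hker h1
    have h2 := hker h2
    rw [MonoidHom.mem_ker] at h1 h2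
    rw [map_mul, h2, hε] at h1
    simp at h1

/-- If `p_1 ≥ 3` is odd, `p_2` is an even positive divisor of `2 p_1`, and `p_3 ≥ 2` is even,
then `Γ(p_1, p_2, p_3)` satisfies the intersection condition, the elements `x_0x_1, x_1x_2,
x_2x_3` have orders exactly `p_1, p_2, p_3`, `|Γ(p_1, p_2, p_3)| = 2 p_1 p_2 p_3`, and the
rotation subgroup has index 2 (i.e. `P(p_1,p_2,p_3)` is a tight orientably-regular polytope
of type `{p_1, p_2, p_3}`). -/
theorem gamma_odd_even_even (p1 p2 p3 : ℕ) (h1 : 3 ≤ p1) (h1odd : Odd p1)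
    (h2pos : 0 < p2) (h2even : Even p2) (h2dvd : p2 ∣ 2 * p1)
    (h3 : 2 ≤ p3) (h3even : Even p3) :
    let P := pfun3 p1 p2 p3
    interCond (xg 4 P) ∧
    orderOf (xg 4 P 0 * xg 4 P 1) = p1 ∧
    orderOf (xg 4 P 1 * xg 4 P 2) = p2 ∧
    orderOf (xg 4 P 2 * xg 4 P 3) = p3 ∧
    Nat.card (Gamma 4 P) = 2 * (p1 * p2 * p3) ∧
    (Subgroup.closure ({xg 4 P 0 * xg 4 P 1, xg 4 P 1 * xg 4 P 2, xg 4 P 2 * xg 4 P 3} :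
      Set (Gamma 4 P))).index = 2 := by
  obtain ⟨q, rfl⟩ := h2even.two_dvd
  have hqp : q ∣ p1 := Nat.dvd_of_mul_dvd_mul_left two_pos h2dvd
  have hq : Odd q := h1odd.of_dvd_nat hqp
  have : NeZero q := ⟨hq.pos.ne'⟩
  have h := gammaRelations_xg (q := q) h1odd h3even
  have hx := PresentedGroup.closure_range_of (gammaRels 4 (pfun3 p1 (2 * q) p3))
  obtain ⟨φ, hφ⟩ := (gammaRelations_dihedralModel hqp h3even).exists_hom h1odd h3even
  obtain ⟨ε, hε⟩ := (gammaRelations_sign p1 q p3).exists_hom h1odd h3even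
  obtain ⟨h01, h12, h23⟩ := h.orderOf_eq hqp hφ hx hq h3even
  exact ⟨h.interCond_of_hom hqp hφ hx hq (by omega) h3, h01, h12, h23,
    h.natCard hqp hφ hx hq, index_rotationSubgroup_eq_two h hx hε⟩
end

section
/- Let p_1 ≥ 3 and p_3 ≥ 3 be odd, and let p_2 be an even positive integer dividing both 2p_1 and 2p_3. Then Γ(p_1, p_2, p_3), with its generating involutions x_0, x_1, x_2, x_3, satisfies the intersection condition; the elements x_0x_1, x_1x_2, x_2x_3 have orders exactly p_1, p_2, p_3 respectively; the order of Γ(p_1, p_2, p_3) equals 2 p_1 p_2 p_3; and the subgroup generated by x_0x_1, x_1x_2, x_2x_3 has index 2. -/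
/-- An extension of a Heisenberg-type group over the rings `A`, `B`, `C` by the signs `s`, `t`
acting on the coordinates `i`, `j`, `k` by `s`, `t` and `s * t`. -/
@[ext]
structure SignedHeis {A B C : Type*} [CommRing A] [CommRing B] [CommRing C]
    (f : A →+* C) (g : B →+* C) where
  /-- the first coordinate -/
  i : A
  /-- the second coordinate -/
  j : B
  /-- the central coordinate -/
  k : C
  /-- the sign acting on the first coordinate -/
  s : ℤˣ
  /-- the sign acting on the second coordinate -/
  t : ℤˣ

namespace SignedHeis

section Ring

variable {A B C : Type*} [CommRing A] [CommRing B] [CommRing C] {f : A →+* C} {g : B →+* C}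

instance : Mul (SignedHeis f g) where
  mul x y :=
    ⟨x.i + ((x.s : ℤ) : A) * y.i, x.j + ((x.t : ℤ) : B) * y.j,
      x.k + ((x.s : ℤ) : C) * ((x.t : ℤ) : C) * y.k + g x.j * ((x.s : ℤ) : C) * f y.i,
      x.s * y.s, x.t * y.t⟩

instance : One (SignedHeis f g) where
  one := ⟨0, 0, 0, 1, 1⟩

instance : Inv (SignedHeis f g) where
  inv x :=
    ⟨-((x.s : ℤ) : A) * x.i, -((x.t : ℤ) : B) * x.j,
      ((x.s : ℤ) : C) * ((x.t : ℤ) : C) * (g x.j * f x.i - x.k), x.s, x.t⟩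

theorem mul_def (x y : SignedHeis f g) : x * y =
    ⟨x.i + ((x.s : ℤ) : A) * y.i, x.j + ((x.t : ℤ) : B) * y.j,
      x.k + ((x.s : ℤ) : C) * ((x.t : ℤ) : C) * y.k + g x.j * ((x.s : ℤ) : C) * f y.i,
      x.s * y.s, x.t * y.t⟩ := rfl

theorem one_def : (1 : SignedHeis f g) = ⟨0, 0, 0, 1, 1⟩ := rfl

theorem inv_def (x : SignedHeis f g) : x⁻¹ =
    ⟨-((x.s : ℤ) : A) * x.i, -((x.t : ℤ) : B) * x.j,
      ((x.s : ℤ) : C) * ((x.t : ℤ) : C) * (g x.j * f x.i - x.k), x.s, x.t⟩ := rfl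

instance : Group (SignedHeis f g) :=
  Group.ofLeftAxioms
    (fun x y z => by
      simp only [mul_def, SignedHeis.mk.injEq, Units.val_mul, Int.cast_mul, map_add, map_mul,
        map_intCast, mul_assoc, and_true]
      refine ⟨by ring, by ring, by ring⟩)
    (fun x => by simp [mul_def, one_def])
    (fun x => by
      simp only [mul_def, inv_def, one_def, SignedHeis.mk.injEq, map_mul, map_neg, map_intCast,
        Int.units_mul_self, and_true]
      refine ⟨by ring, by ring, by ring⟩)

variable (f g) in
/-- The four generating involutions. -/
def gen : Fin 4 → SignedHeis f g :=
  ![⟨0, 0, 0, -1, 1⟩, ⟨-1, 0, 0, -1, 1⟩, ⟨0, 1, 0, 1, -1⟩, ⟨0, 0, 0, 1, -1⟩]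

theorem first_pow (n : ℕ) : (⟨1, 0, 0, 1, 1⟩ : SignedHeis f g) ^ n = ⟨n, 0, 0, 1, 1⟩ := by
  induction n with
  | zero => simp [one_def]
  | succ n ih => rw [pow_succ, ih]; simp [mul_def]

theorem second_pow (n : ℕ) : (⟨0, 1, 0, 1, 1⟩ : SignedHeis f g) ^ n = ⟨0, n, 0, 1, 1⟩ := by
  induction n with
  | zero => simp [one_def]
  | succ n ih => rw [pow_succ, ih]; simp [mul_def]

theorem central_pow (n : ℕ) : (⟨0, 0, 1, 1, 1⟩ : SignedHeis f g) ^ n = ⟨0, 0, n, 1, 1⟩ := by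
  induction n with
  | zero => simp [one_def]
  | succ n ih => rw [pow_succ, ih]; simp [mul_def]

theorem first_zpow (n : ℤ) : (⟨1, 0, 0, 1, 1⟩ : SignedHeis f g) ^ n = ⟨n, 0, 0, 1, 1⟩ := by
  cases n with
  | ofNat n => simp [first_pow]
  | negSucc n => rw [zpow_negSucc, first_pow, inv_def]; simp [Int.negSucc_eq]

theorem second_zpow (n : ℤ) : (⟨0, 1, 0, 1, 1⟩ : SignedHeis f g) ^ n = ⟨0, n, 0, 1, 1⟩ := by
  cases n with
  | ofNat n => simp [second_pow]
  | negSucc n => rw [zpow_negSucc, second_pow, inv_def]; simp [Int.negSucc_eq]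

theorem central_zpow (n : ℤ) : (⟨0, 0, 1, 1, 1⟩ : SignedHeis f g) ^ n = ⟨0, 0, n, 1, 1⟩ := by
  cases n with
  | ofNat n => simp [central_pow]
  | negSucc n => rw [zpow_negSucc, central_pow, inv_def]; simp [Int.negSucc_eq]

theorem gen_zero_mul_gen_one : gen f g 0 * gen f g 1 = ⟨1, 0, 0, 1, 1⟩ := by
  simp [gen, mul_def]

theorem gen_two_mul_gen_three : gen f g 2 * gen f g 3 = ⟨0, 1, 0, 1, 1⟩ := by
  simp [gen, mul_def]

theorem gen_one_mul_gen_two_sq : (gen f g 1 * gen f g 2) ^ 2 = ⟨0, 0, 1, 1, 1⟩ := by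
  simp [gen, mul_def, sq]

theorem gen_zero_pow (n : ℕ) : gen f g 0 ^ n = ⟨0, 0, 0, (-1) ^ n, 1⟩ := by
  induction n with
  | zero => simp [one_def]
  | succ n ih => rw [pow_succ, ih]; simp [gen, mul_def, pow_succ]

theorem gen_three_pow (n : ℕ) : gen f g 3 ^ n = ⟨0, 0, 0, 1, (-1) ^ n⟩ := by
  induction n with
  | zero => simp [one_def]
  | succ n ih => rw [pow_succ, ih]; simp [gen, mul_def, pow_succ]

theorem eq_mul_mul (x : SignedHeis f g) :
    x = ⟨0, 0, x.k, 1, 1⟩ * (⟨x.i, 0, 0, x.s, 1⟩ * ⟨0, x.j, 0, 1, x.t⟩) := by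
  ext <;> simp [mul_def]

variable (f g) in
/-- The subgroup generated by all generators but the `m`-th, described by coordinates. -/
def maxParabolic (m : Fin 4) : Subgroup (SignedHeis f g) :=
  ![{ carrier := {x | x.s = 1 ∧ x.i = 0 ∨ x.s = -1 ∧ x.i = -1}
      one_mem' := by simp [one_def]
      mul_mem' := by
        rintro x y (⟨hs, hi⟩ | ⟨hs, hi⟩) (⟨hs', hi'⟩ | ⟨hs', hi'⟩) <;>
          simp [mul_def, hs, hi, hs', hi']
      inv_mem' := by
        rintro x (⟨hs, hi⟩ | ⟨hs, hi⟩) <;> simp [inv_def, hs, hi] },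
    { carrier := {x | x.i = 0 ∧ x.k = 0}
      one_mem' := by simp [one_def]
      mul_mem' := by
        rintro x y ⟨hi, hk⟩ ⟨hi', hk'⟩
        simp [mul_def, hi, hk, hi', hk']
      inv_mem' := by
        rintro x ⟨hi, hk⟩
        simp [inv_def, hi, hk] },
    { carrier := {x | x.j = 0 ∧ x.k = 0}
      one_mem' := by simp [one_def]
      mul_mem' := by
        rintro x y ⟨hj, hk⟩ ⟨hj', hk'⟩
        simp [mul_def, hj, hk, hj', hk']
      inv_mem' := by
        rintro x ⟨hj, hk⟩
        simp [inv_def, hj, hk] },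
    { carrier := {x | x.t = 1 ∧ x.j = 0 ∨ x.t = -1 ∧ x.j = 1}
      one_mem' := by simp [one_def]
      mul_mem' := by
        rintro x y (⟨ht, hj⟩ | ⟨ht, hj⟩) (⟨ht', hj'⟩ | ⟨ht', hj'⟩) <;>
          simp [mul_def, ht, hj, ht', hj']
      inv_mem' := by
        rintro x (⟨ht, hj⟩ | ⟨ht, hj⟩) <;> simp [inv_def, ht, hj] }] m

theorem mem_maxParabolic_zero {x : SignedHeis f g} :
    x ∈ maxParabolic f g 0 ↔ (x.s = 1 ∧ x.i = 0 ∨ x.s = -1 ∧ x.i = -1) := Iff.rfl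

theorem mem_maxParabolic_one {x : SignedHeis f g} :
    x ∈ maxParabolic f g 1 ↔ x.i = 0 ∧ x.k = 0 := Iff.rfl

theorem mem_maxParabolic_two {x : SignedHeis f g} :
    x ∈ maxParabolic f g 2 ↔ x.j = 0 ∧ x.k = 0 := Iff.rfl

theorem mem_maxParabolic_three {x : SignedHeis f g} :
    x ∈ maxParabolic f g 3 ↔ (x.t = 1 ∧ x.j = 0 ∨ x.t = -1 ∧ x.j = 1) := Iff.rfl

theorem gen_mem_maxParabolic {l m : Fin 4} (h : l ≠ m) : gen f g l ∈ maxParabolic f g m := by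
  fin_cases m <;> fin_cases l <;>
    simp_all [gen, mem_maxParabolic_zero, mem_maxParabolic_one, mem_maxParabolic_two,
      mem_maxParabolic_three]

end Ring

section ZMod

variable {a b c : ℕ} {f : ZMod a →+* ZMod c} {g : ZMod b →+* ZMod c}

theorem central_mem {H : Subgroup (SignedHeis f g)} (h1 : gen f g 1 ∈ H) (h2 : gen f g 2 ∈ H)
    (k : ZMod c) : (⟨0, 0, k, 1, 1⟩ : SignedHeis f g) ∈ H := by
  obtain ⟨n, rfl⟩ := ZMod.intCast_surjective k
  rw [← central_zpow, ← gen_one_mul_gen_two_sq]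
  exact H.zpow_mem (H.pow_mem (H.mul_mem h1 h2) 2) n

theorem first_mem {H : Subgroup (SignedHeis f g)} (h : gen f g 0 * gen f g 1 ∈ H) (i : ZMod a) :
    (⟨i, 0, 0, 1, 1⟩ : SignedHeis f g) ∈ H := by
  obtain ⟨n, rfl⟩ := ZMod.intCast_surjective i
  rw [← first_zpow, ← gen_zero_mul_gen_one]
  exact H.zpow_mem h n

theorem second_mem {H : Subgroup (SignedHeis f g)} (h : gen f g 2 * gen f g 3 ∈ H) (j : ZMod b) :
    (⟨0, j, 0, 1, 1⟩ : SignedHeis f g) ∈ H := by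
  obtain ⟨n, rfl⟩ := ZMod.intCast_surjective j
  rw [← second_zpow, ← gen_two_mul_gen_three]
  exact H.zpow_mem h n

theorem left_mem (ha : (-1 : ZMod a) ≠ 0) {I : Set (Fin 4)} {x : SignedHeis f g}
    (hx : ∀ m ∉ I, x ∈ maxParabolic f g m) :
    (⟨x.i, 0, 0, x.s, 1⟩ : SignedHeis f g) ∈ Subgroup.closure (gen f g '' I) := by
  have hgen : ∀ m ∈ I, gen f g m ∈ Subgroup.closure (gen f g '' I) := fun m hm =>
    Subgroup.subset_closure ⟨m, hm, rfl⟩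
  by_cases h0 : (0 : Fin 4) ∈ I
  · have key : (⟨x.i, 0, 0, 1, 1⟩ : SignedHeis f g) ∈ Subgroup.closure (gen f g '' I) := by
      by_cases h1 : (1 : Fin 4) ∈ I
      · exact first_mem (mul_mem (hgen 0 h0) (hgen 1 h1)) _
      · rw [(mem_maxParabolic_one.1 (hx 1 h1)).1, ← one_def]
        exact one_mem _
    rcases Int.units_eq_one_or x.s with hs | hs
    · rwa [hs]
    · have : (⟨x.i, 0, 0, x.s, 1⟩ : SignedHeis f g) = ⟨x.i, 0, 0, 1, 1⟩ * gen f g 0 := by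
        simp [mul_def, gen, hs]
      rw [this]
      exact mul_mem key (hgen 0 h0)
  · rcases mem_maxParabolic_zero.1 (hx 0 h0) with ⟨hs, hi⟩ | ⟨hs, hi⟩
    · rw [hs, hi, ← one_def]
      exact one_mem _
    · by_cases h1 : (1 : Fin 4) ∈ I
      · rw [hs, hi]
        exact hgen 1 h1
      · exact absurd (hi.symm.trans (mem_maxParabolic_one.1 (hx 1 h1)).1) ha

theorem right_mem (hb : (1 : ZMod b) ≠ 0) {I : Set (Fin 4)} {x : SignedHeis f g}
    (hx : ∀ m ∉ I, x ∈ maxParabolic f g m) :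
    (⟨0, x.j, 0, 1, x.t⟩ : SignedHeis f g) ∈ Subgroup.closure (gen f g '' I) := by
  have hgen : ∀ m ∈ I, gen f g m ∈ Subgroup.closure (gen f g '' I) := fun m hm =>
    Subgroup.subset_closure ⟨m, hm, rfl⟩
  by_cases h3 : (3 : Fin 4) ∈ I
  · have key : (⟨0, x.j, 0, 1, 1⟩ : SignedHeis f g) ∈ Subgroup.closure (gen f g '' I) := by
      by_cases h2 : (2 : Fin 4) ∈ I
      · exact second_mem (mul_mem (hgen 2 h2) (hgen 3 h3)) _
      · rw [(mem_maxParabolic_two.1 (hx 2 h2)).1, ← one_def]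
        exact one_mem _
    rcases Int.units_eq_one_or x.t with ht | ht
    · rwa [ht]
    · have : (⟨0, x.j, 0, 1, x.t⟩ : SignedHeis f g) = ⟨0, x.j, 0, 1, 1⟩ * gen f g 3 := by
        simp [mul_def, gen, ht]
      rw [this]
      exact mul_mem key (hgen 3 h3)
  · rcases mem_maxParabolic_three.1 (hx 3 h3) with ⟨ht, hj⟩ | ⟨ht, hj⟩
    · rw [ht, hj, ← one_def]
      exact one_mem _
    · by_cases h2 : (2 : Fin 4) ∈ I
      · rw [ht, hj]
        exact hgen 2 h2
      · exact absurd (hj.symm.trans (mem_maxParabolic_two.1 (hx 2 h2)).1) hb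

theorem mem_closure_gen_iff (ha : (-1 : ZMod a) ≠ 0) (hb : (1 : ZMod b) ≠ 0) {I : Set (Fin 4)}
    {x : SignedHeis f g} :
    x ∈ Subgroup.closure (gen f g '' I) ↔ ∀ m ∉ I, x ∈ maxParabolic f g m := by
  refine ⟨fun hx m hm => ?_, fun hx => ?_⟩
  · refine (Subgroup.closure_le _).2 ?_ hx
    rintro _ ⟨l, hl, rfl⟩
    exact gen_mem_maxParabolic (by rintro rfl; exact hm hl)
  · rw [eq_mul_mul x]
    refine mul_mem ?_ (mul_mem (left_mem ha hx) (right_mem hb hx))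
    by_cases h1 : (1 : Fin 4) ∈ I
    · by_cases h2 : (2 : Fin 4) ∈ I
      · exact central_mem (Subgroup.subset_closure (Set.mem_image_of_mem _ h1))
          (Subgroup.subset_closure (Set.mem_image_of_mem _ h2)) _
      · rw [(mem_maxParabolic_two.1 (hx 2 h2)).2, ← one_def]
        exact one_mem _
    · rw [(mem_maxParabolic_one.1 (hx 1 h1)).2, ← one_def]
      exact one_mem _

theorem interCond_gen (ha : (-1 : ZMod a) ≠ 0) (hb : (1 : ZMod b) ≠ 0) : interCond (gen f g) := by
  intro I J
  ext x
  simp only [Subgroup.mem_inf, mem_closure_gen_iff ha hb, Set.mem_inter_iff, not_and_or]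
  exact ⟨fun h m hm => hm.elim (h.1 m) (h.2 m), fun h => ⟨fun m hm => h m (.inl hm),
    fun m hm => h m (.inr hm)⟩⟩

theorem closure_range_gen (ha : (-1 : ZMod a) ≠ 0) (hb : (1 : ZMod b) ≠ 0) :
    Subgroup.closure (Set.range (gen f g)) = ⊤ := by
  rw [← Set.image_univ, eq_top_iff]
  intro x _
  exact (mem_closure_gen_iff ha hb).2 fun m hm => absurd (Set.mem_univ m) hm

theorem orderOf_gen_zero_mul_gen_one : orderOf (gen f g 0 * gen f g 1) = a := by
  refine Nat.dvd_antisymm (orderOf_dvd_of_pow_eq_one ?_) ?_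
  · simp [gen_zero_mul_gen_one, first_pow, one_def]
  · have h := pow_orderOf_eq_one (gen f g 0 * gen f g 1)
    rw [gen_zero_mul_gen_one, first_pow, one_def] at h
    rw [gen_zero_mul_gen_one]
    exact (ZMod.natCast_eq_zero_iff _ _).1 (congrArg SignedHeis.i h)

theorem orderOf_gen_two_mul_gen_three : orderOf (gen f g 2 * gen f g 3) = b := by
  refine Nat.dvd_antisymm (orderOf_dvd_of_pow_eq_one ?_) ?_
  · simp [gen_two_mul_gen_three, second_pow, one_def]
  · have h := pow_orderOf_eq_one (gen f g 2 * gen f g 3)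
    rw [gen_two_mul_gen_three, second_pow, one_def] at h
    rw [gen_two_mul_gen_three]
    exact (ZMod.natCast_eq_zero_iff _ _).1 (congrArg SignedHeis.j h)

theorem orderOf_gen_one_mul_gen_two : orderOf (gen f g 1 * gen f g 2) = 2 * c := by
  set y := gen f g 1 * gen f g 2 with hy
  refine Nat.dvd_antisymm (orderOf_dvd_of_pow_eq_one ?_) ?_
  · rw [pow_mul, gen_one_mul_gen_two_sq, central_pow]
    simp [one_def]
  · have h := pow_orderOf_eq_one y
    rcases Nat.even_or_odd' (orderOf y) with ⟨n, hn | hn⟩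
    · rw [hn, pow_mul, hy, gen_one_mul_gen_two_sq, central_pow, one_def] at h
      rw [hn]
      exact mul_dvd_mul_left 2 ((ZMod.natCast_eq_zero_iff _ _).1 (congrArg SignedHeis.k h))
    · rw [hn, pow_succ, pow_mul, hy, gen_one_mul_gen_two_sq, central_pow, one_def] at h
      have hs := congrArg SignedHeis.s h
      simp [gen, mul_def] at hs

variable (f g) in
/-- The tuple of coordinates of an element. -/
def equivProd : SignedHeis f g ≃ ZMod a × ZMod b × ZMod c × ℤˣ × ℤˣ where
  toFun x := (x.i, x.j, x.k, x.s, x.t)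
  invFun x := ⟨x.1, x.2.1, x.2.2.1, x.2.2.2.1, x.2.2.2.2⟩

variable (f g) in
theorem natCard : Nat.card (SignedHeis f g) = 2 * (a * (2 * c) * b) := by
  rw [Nat.card_congr (equivProd f g)]
  simp only [Nat.card_prod, Nat.card_zmod, Nat.card_eq_fintype_card (α := ℤˣ),
    Fintype.card_units_int]
  ring

theorem index_rotation : (Subgroup.closure ({gen f g 0 * gen f g 1, gen f g 1 * gen f g 2,
    gen f g 2 * gen f g 3} : Set (SignedHeis f g))).index = 2 := by
  set R := Subgroup.closure ({gen f g 0 * gen f g 1, gen f g 1 * gen f g 2,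
    gen f g 2 * gen f g 3} : Set (SignedHeis f g)) with hR
  have h01 : gen f g 0 * gen f g 1 ∈ R := Subgroup.subset_closure (by simp)
  have h12 : gen f g 1 * gen f g 2 ∈ R := Subgroup.subset_closure (by simp)
  have h23 : gen f g 2 * gen f g 3 ∈ R := Subgroup.subset_closure (by simp)
  have hcentral (k : ZMod c) : (⟨0, 0, k, 1, 1⟩ : SignedHeis f g) ∈ R := by
    obtain ⟨n, rfl⟩ := ZMod.intCast_surjective k
    rw [← central_zpow, ← gen_one_mul_gen_two_sq]
    exact R.zpow_mem (R.pow_mem h12 2) n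
  let χ : SignedHeis f g →* ℤˣ :=
    { toFun := fun x => x.s * x.t
      map_one' := by simp [one_def]
      map_mul' := fun x y => by simp [mul_def, mul_mul_mul_comm] }
  have hker : R = χ.ker := by
    refine le_antisymm ((Subgroup.closure_le _).2 ?_) fun x hx => ?_
    · rintro _ (rfl | rfl | rfl) <;> simp [χ, gen, mul_def, MonoidHom.mem_ker]
    · have hx : x.s * x.t = 1 := hx
      have key (y : SignedHeis f g) : (⟨0, 0, y.k, 1, 1⟩ : SignedHeis f g) *
          ((⟨y.i, 0, 0, 1, 1⟩ : SignedHeis f g) * (⟨0, y.j, 0, 1, 1⟩ : SignedHeis f g)) ∈ R :=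
        mul_mem (hcentral _) (mul_mem (first_mem h01 _) (second_mem h23 _))
      have ht : x.t = x.s := by
        rw [← mul_left_cancel_iff (a := x.s), hx, Int.units_mul_self]
      rcases Int.units_eq_one_or x.s with hs | hs
      · convert key x using 1
        ext <;> simp [mul_def, ht, hs]
      · have h03 := mul_mem h01 (mul_mem h12 h23)
        convert mul_mem (key x) h03 using 1
        ext <;> simp [mul_def, gen, ht, hs]
  rw [hker, Subgroup.index_ker, MonoidHom.range_eq_top.2, Subgroup.card_top,
    Nat.card_eq_fintype_card, Fintype.card_units_int]
  exact fun u => ⟨⟨0, 0, 0, u, 1⟩, by simp [χ]⟩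

end ZMod

end SignedHeis

/-- Let `x 0, …, x 3` be involutions satisfying the commutation relations of a string C-group and
such that `x 0` and `x 3` invert `(x 1 * x 2) ^ 2`. Then `(x 1 * x 2) ^ 2` generates a normal
subgroup of the group they generate, and every element has the normal form below. -/
theorem exists_normal_form {G : Type*} [Group G] {x : Fin 4 → G} (hsq : ∀ i, x i * x i = 1)
    (h02 : Commute (x 0) (x 2)) (h03 : Commute (x 0) (x 3)) (h13 : Commute (x 1) (x 3))
    (h012 : (x 0 * x 1 * x 2 * x 1 * x 2) ^ 2 = 1) (h321 : (x 3 * x 2 * x 1 * x 2 * x 1) ^ 2 = 1)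
    {y : G} (hy : y ∈ Subgroup.closure (Set.range x)) :
    ∃ (k i : ℤ) (e : ℕ) (j : ℤ) (d : ℕ), y = ((x 1 * x 2) ^ 2) ^ k * (x 0 * x 1) ^ i * x 0 ^ e *
      (x 2 * x 3) ^ j * x 3 ^ d := by
  have hinv (i) : (x i)⁻¹ = x i := inv_eq_of_mul_eq_one_left (hsq i)
  have hcancel (i) (z : G) : x i * (x i * z) = z := by rw [← mul_assoc, hsq, one_mul]
  set τ := (x 1 * x 2) ^ 2 with hτ
  have hτ' : τ⁻¹ = (x 2 * x 1) ^ 2 := by rw [hτ, ← inv_pow, mul_inv_rev, hinv, hinv]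
  have h0τ : SemiconjBy (x 0) τ τ⁻¹ := by
    have h : (x 0 * τ) * (x 0 * τ) = 1 := by
      rw [← h012, hτ]
      simp only [sq, mul_assoc]
    rw [SemiconjBy, ← inv_eq_of_mul_eq_one_left h, mul_inv_rev, hinv]
  have h1τ : SemiconjBy (x 1) τ τ⁻¹ := by
    rw [SemiconjBy, hτ', hτ]
    simp only [sq, mul_assoc, hcancel, hsq, mul_one]
  have h2τ : SemiconjBy (x 2) τ τ⁻¹ := by
    rw [SemiconjBy, hτ', hτ]
    simp only [sq, mul_assoc]
  have h3τ : SemiconjBy (x 3) τ τ⁻¹ := by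
    have h : (x 3 * τ⁻¹) * (x 3 * τ⁻¹) = 1 := by
      rw [← h321, hτ']
      simp only [sq, mul_assoc]
    rw [← SemiconjBy.inv_right_iff, inv_inv, SemiconjBy, ← inv_eq_of_mul_eq_one_left h,
      mul_inv_rev, hinv, inv_inv]
  have haτ : Commute (x 0 * x 1) τ := by
    have h := h0τ.inv_right.mul_left h1τ
    rwa [inv_inv] at h
  have hbτ : Commute (x 2 * x 3) τ := by
    have h := h2τ.inv_right.mul_left h3τ
    rwa [inv_inv] at h
  have h0a : SemiconjBy (x 0) (x 0 * x 1) (x 0 * x 1)⁻¹ := by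
    simp [SemiconjBy, hinv, hcancel, mul_assoc, hsq]
  have h3b : SemiconjBy (x 3) (x 2 * x 3) (x 2 * x 3)⁻¹ := by
    simp [SemiconjBy, hinv, mul_assoc]
  have h0b : Commute (x 0) (x 2 * x 3) := h02.mul_right h03
  have h3a : Commute (x 3) (x 0 * x 1) := h03.symm.mul_right h13.symm
  have hba : SemiconjBy (x 2 * x 3) (x 0 * x 1) (x 0 * x 1 * τ) := by
    have h : SemiconjBy (x 2) (x 0 * x 1) (x 0 * x 1 * τ) := by
      rw [SemiconjBy, ← mul_assoc, ← h02.eq, hτ]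
      simp only [sq, mul_assoc, hcancel, hsq, mul_one]
    exact h.mul_left h3a
  let NF : Set G := {y | ∃ (k i : ℤ) (e : ℕ) (j : ℤ) (d : ℕ), y = τ ^ k * (x 0 * x 1) ^ i *
    x 0 ^ e * (x 2 * x 3) ^ j * x 3 ^ d}
  have m0 : ∀ y ∈ NF, x 0 * y ∈ NF := by
    rintro _ ⟨k, i, e, j, d, rfl⟩
    refine ⟨-k, -i, e + 1, j, d, ?_⟩
    have h := (h0τ.zpow_right k).mul_right (h0a.zpow_right i)
    simp only [mul_assoc] at h ⊢
    rw [← mul_assoc (τ ^ k), ← mul_assoc, h.eq, pow_succ']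
    simp only [mul_assoc, inv_zpow, zpow_neg]
  have ma : ∀ y ∈ NF, x 0 * x 1 * y ∈ NF := by
    rintro _ ⟨k, i, e, j, d, rfl⟩
    refine ⟨k, i + 1, e, j, d, ?_⟩
    rw [add_comm, zpow_one_add, ← mul_assoc (τ ^ k), ← (haτ.zpow_right k).eq]
    simp only [mul_assoc]
  have m3 : ∀ y ∈ NF, x 3 * y ∈ NF := by
    rintro _ ⟨k, i, e, j, d, rfl⟩
    refine ⟨-k, i, e, -j, d + 1, ?_⟩
    have h := (((h3τ.zpow_right k).mul_right (h3a.zpow_right i)).mul_right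
      (h03.symm.pow_right e)).mul_right (h3b.zpow_right j)
    rw [← mul_assoc, h.eq, pow_succ']
    simp only [mul_assoc, inv_zpow, zpow_neg]
  have mb : ∀ y ∈ NF, x 2 * x 3 * y ∈ NF := by
    rintro _ ⟨k, i, e, j, d, rfl⟩
    refine ⟨k + i, i, e, j + 1, d, ?_⟩
    have h := ((hbτ.zpow_right k).semiconjBy.mul_right (hba.zpow_right i)).mul_right
      (h0b.symm.pow_right e)
    rw [← mul_assoc, ← mul_assoc, h.eq, haτ.mul_zpow, (haτ.zpow_zpow i i).eq, add_comm j,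
      zpow_one_add, zpow_add]
    simp only [mul_assoc]
  have m1 : ∀ y ∈ NF, x 1 * y ∈ NF := fun y h => by
    simpa only [mul_assoc, hcancel] using m0 _ (ma y h)
  have m2 : ∀ y ∈ NF, x 2 * y ∈ NF := fun y h => by
    simpa only [mul_assoc, hcancel] using mb _ (m3 y h)
  have m : ∀ l, ∀ y ∈ NF, x l * y ∈ NF := by
    intro l
    fin_cases l
    exacts [m0, m1, m2, m3]
  change y ∈ NF
  induction hy using Subgroup.closure_induction_left with
  | one => exact ⟨0, 0, 0, 0, 0, by simp⟩
  | mul_left z hz w _ ih =>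
    obtain ⟨l, rfl⟩ := hz
    exact m l w ih
  | inv_mul_cancel z hz w _ ih =>
    obtain ⟨l, rfl⟩ := hz
    rw [hinv]
    exact m l w ih

theorem interCond.of_comp_injective {G H : Type*} [Group G] [Group H] {n : ℕ} {ρ : Fin n → G}
    {σ : Fin n → H} (hσ : interCond σ) {φ : G →* H} (hφ : Function.Injective φ)
    (h : φ ∘ ρ = σ) : interCond ρ := by
  intro I J
  apply Subgroup.map_injective hφ
  rw [Subgroup.map_inf _ _ _ hφ]
  simp only [MonoidHom.map_closure, ← Set.image_comp, h]
  exact hσ I J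

section Gamma

variable {p1 p3 q : ℕ}

theorem gamma_rel {n : ℕ} {p : ℕ → ℕ} {w : FreeGroup (Fin n)} (h : w ∈ gammaRels n p) :
    FreeGroup.lift (xg n p) w = 1 := by
  have h' := PresentedGroup.one_of_mem h
  have e : FreeGroup.lift (xg n p) = PresentedGroup.mk (gammaRels n p) := by
    ext i
    simp [xg, PresentedGroup.of]
  rwa [e]

theorem closure_range_xg (n : ℕ) (p : ℕ → ℕ) : Subgroup.closure (Set.range (xg n p)) = ⊤ :=
  PresentedGroup.closure_range_of _

theorem lift_gen_of_mem_gammaRels (h1odd : Odd p1) (h3odd : Odd p3)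
    (f : ZMod p1 →+* ZMod q) (g : ZMod p3 →+* ZMod q) :
    ∀ w ∈ gammaRels 4 (pfun3 p1 (2 * q) p3), FreeGroup.lift (SignedHeis.gen f g) w = 1 := by
  rintro w (⟨i, rfl⟩ | ⟨i, j, hij, rfl⟩ | ⟨i, j, hij, rfl⟩ | ⟨a, b, c, hab, hbc, h⟩)
  · fin_cases i <;> simp [SignedHeis.gen, SignedHeis.mul_def, SignedHeis.one_def, sq]
  · simp only [map_pow, map_mul, FreeGroup.lift_apply_of]
    rw [← orderOf_dvd_iff_pow_eq_one]
    fin_cases i <;> fin_cases j <;> simp at hij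
    · exact SignedHeis.orderOf_gen_zero_mul_gen_one.dvd
    · exact SignedHeis.orderOf_gen_one_mul_gen_two.dvd
    · exact SignedHeis.orderOf_gen_two_mul_gen_three.dvd
  · fin_cases i <;> fin_cases j <;> simp at hij <;>
      simp [SignedHeis.gen, SignedHeis.mul_def, SignedHeis.one_def, sq]
  · fin_cases a <;> fin_cases b <;> simp at hab <;> fin_cases c <;> simp at hbc
    · rcases h with ⟨h, -, -⟩ | ⟨-, -, rfl⟩ | ⟨h, -, -⟩
      · exact absurd h1odd (Nat.not_odd_iff_even.2 h)
      · simp [SignedHeis.gen, SignedHeis.mul_def, SignedHeis.one_def, sq]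
      · exact absurd h1odd (Nat.not_odd_iff_even.2 h)
    · rcases h with ⟨-, h, -⟩ | ⟨-, h, -⟩ | ⟨-, -, rfl⟩
      · exact absurd h3odd (Nat.not_odd_iff_even.2 h)
      · exact absurd h3odd (Nat.not_odd_iff_even.2 h)
      · simp [SignedHeis.gen, SignedHeis.mul_def, SignedHeis.one_def, sq]

/-- The homomorphism from `Γ(p1, 2q, p3)` to the coordinate model. -/
def gammaHom (h1odd : Odd p1) (h3odd : Odd p3) (f : ZMod p1 →+* ZMod q)
    (g : ZMod p3 →+* ZMod q) : Gamma 4 (pfun3 p1 (2 * q) p3) →* SignedHeis f g :=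
  PresentedGroup.toGroup (lift_gen_of_mem_gammaRels h1odd h3odd f g)

theorem gammaHom_xg (h1odd : Odd p1) (h3odd : Odd p3) (f : ZMod p1 →+* ZMod q)
    (g : ZMod p3 →+* ZMod q) (i : Fin 4) :
    gammaHom h1odd h3odd f g (xg 4 _ i) = SignedHeis.gen f g i :=
  PresentedGroup.toGroup.of _

theorem gammaHom_injective (h1odd : Odd p1) (h3odd : Odd p3) (f : ZMod p1 →+* ZMod q)
    (g : ZMod p3 →+* ZMod q) : Function.Injective (gammaHom h1odd h3odd f g) := by
  set P := pfun3 p1 (2 * q) p3 with hP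
  rw [injective_iff_map_eq_one]
  intro y hy
  have hsq (i) : xg 4 P i * xg 4 P i = 1 := by
    simpa [sq] using gamma_rel (p := P) (.inl ⟨i, rfl⟩)
  have hcomm (i j : Fin 4) (h : (i : ℕ) + 2 ≤ j) : Commute (xg 4 P i) (xg 4 P j) := by
    have := gamma_rel (p := P) (.inr (.inr (.inl ⟨i, j, h, rfl⟩)))
    simp only [map_mul, FreeGroup.lift_apply_of, sq] at this
    rw [Commute, SemiconjBy, ← inv_eq_of_mul_eq_one_left this, mul_inv_rev,
      inv_eq_of_mul_eq_one_left (hsq i), inv_eq_of_mul_eq_one_left (hsq j)]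
  have hpow (i j : Fin 4) (h : (i : ℕ) + 1 = j) : (xg 4 P i * xg 4 P j) ^ P j = 1 := by
    simpa using gamma_rel (p := P) (.inr (.inl ⟨i, j, h, rfl⟩))
  have h012 := gamma_rel (p := P) (.inr (.inr (.inr ⟨(0 : Fin 4), (1 : Fin 4),
    (2 : Fin 4), rfl, rfl, .inr (.inl ⟨h1odd, even_two_mul q, rfl⟩)⟩)))
  have h321 := gamma_rel (p := P) (.inr (.inr (.inr ⟨(1 : Fin 4), (2 : Fin 4),
    (3 : Fin 4), rfl, rfl, .inr (.inr ⟨even_two_mul q, h3odd, rfl⟩)⟩)))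
  simp only [map_pow, map_mul, FreeGroup.lift_apply_of] at h012 h321
  obtain ⟨k, i, e, j, d, rfl⟩ := exists_normal_form hsq (hcomm 0 2 (by simp))
    (hcomm 0 3 (by simp)) (hcomm 1 3 (by simp)) h012 h321
    (y := y) (by rw [closure_range_xg]; exact Subgroup.mem_top y)
  have hgen (l) : gammaHom h1odd h3odd f g (xg 4 P l) = SignedHeis.gen f g l :=
    gammaHom_xg h1odd h3odd f g l
  have hval : gammaHom h1odd h3odd f g (((xg 4 P 1 * xg 4 P 2) ^ 2) ^ k *
      (xg 4 P 0 * xg 4 P 1) ^ i * xg 4 P 0 ^ e * (xg 4 P 2 * xg 4 P 3) ^ j * xg 4 P 3 ^ d) =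
      ⟨i, j, k, (-1) ^ e, (-1) ^ d⟩ := by
    simp only [map_mul, map_pow, map_zpow, hgen, SignedHeis.gen_one_mul_gen_two_sq,
      SignedHeis.gen_zero_mul_gen_one, SignedHeis.gen_two_mul_gen_three, SignedHeis.first_zpow,
      SignedHeis.second_zpow, SignedHeis.central_zpow,
      SignedHeis.gen_zero_pow, SignedHeis.gen_three_pow]
    simp [SignedHeis.mul_def]
  rw [hval, SignedHeis.one_def, SignedHeis.mk.injEq] at hy
  obtain ⟨hi, hj, hk, he, hd⟩ := hy
  have heven {n : ℕ} (h : (-1 : ℤˣ) ^ n = 1) (l : Fin 4) : xg 4 P l ^ n = 1 := by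
    have hn : Even n := by
      rw [← Nat.not_odd_iff_even]
      intro hn
      rw [hn.neg_one_pow] at h
      exact absurd h (by decide)
    obtain ⟨r, rfl⟩ := hn
    rw [← two_mul, pow_mul, sq, hsq, one_pow]
  have hzpow {z : Gamma 4 P} {n : ℕ} {l : ℤ} (hz : z ^ n = 1) (hl : (l : ZMod n) = 0) :
      z ^ l = 1 := by
    obtain ⟨r, rfl⟩ := (ZMod.intCast_zmod_eq_zero_iff_dvd _ _).1 hl
    rw [zpow_mul, zpow_natCast, hz, one_zpow]
  rw [heven he, heven hd, hzpow (hpow 0 1 rfl) hi, hzpow (hpow 2 3 rfl) hj,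
    hzpow ((pow_mul _ _ _).symm.trans (hpow 1 2 rfl)) hk]
  simp

end Gamma

/-- If `p_1, p_3 ≥ 3` are odd and `p_2` is an even positive divisor of both `2 p_1` and
`2 p_3`, then `Γ(p_1, p_2, p_3)` satisfies the intersection condition, the elements
`x_0x_1, x_1x_2, x_2x_3` have orders exactly `p_1, p_2, p_3`,
`|Γ(p_1, p_2, p_3)| = 2 p_1 p_2 p_3`, and the rotation subgroup has index 2
(i.e. `P(p_1,p_2,p_3)` is a tight orientably-regular polytope of type `{p_1, p_2, p_3}`). -/
theorem gamma_odd_even_odd (p1 p2 p3 : ℕ) (h1 : 3 ≤ p1) (h1odd : Odd p1)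
    (h2pos : 0 < p2) (h2even : Even p2) (h2dvd1 : p2 ∣ 2 * p1)
    (h3 : 3 ≤ p3) (h3odd : Odd p3) (h2dvd3 : p2 ∣ 2 * p3) :
    let P := pfun3 p1 p2 p3
    interCond (xg 4 P) ∧
    orderOf (xg 4 P 0 * xg 4 P 1) = p1 ∧
    orderOf (xg 4 P 1 * xg 4 P 2) = p2 ∧
    orderOf (xg 4 P 2 * xg 4 P 3) = p3 ∧
    Nat.card (Gamma 4 P) = 2 * (p1 * p2 * p3) ∧
    (Subgroup.closure ({xg 4 P 0 * xg 4 P 1, xg 4 P 1 * xg 4 P 2, xg 4 P 2 * xg 4 P 3} :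
      Set (Gamma 4 P))).index = 2 := by
  intro P
  obtain ⟨q, rfl⟩ := h2even.two_dvd
  have hq1 : q ∣ p1 := Nat.dvd_of_mul_dvd_mul_left two_pos h2dvd1
  have hq3 : q ∣ p3 := Nat.dvd_of_mul_dvd_mul_left two_pos h2dvd3
  have : Fact (1 < p1) := ⟨by lia⟩
  have : Fact (1 < p3) := ⟨by lia⟩
  have ha : (-1 : ZMod p1) ≠ 0 := neg_ne_zero.2 one_ne_zero
  have hb : (1 : ZMod p3) ≠ 0 := one_ne_zero
  let f := ZMod.castHom hq1 (ZMod q)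
  let g := ZMod.castHom hq3 (ZMod q)
  let φ := gammaHom h1odd h3odd f g
  have hφ (i) : φ (xg 4 P i) = SignedHeis.gen f g i := gammaHom_xg h1odd h3odd f g i
  have hinj : Function.Injective φ := gammaHom_injective h1odd h3odd f g
  have hcomp : φ ∘ xg 4 P = SignedHeis.gen f g := funext hφ
  have hsurj : Function.Surjective φ := by
    rw [← MonoidHom.range_eq_top, ← top_le_iff, ← SignedHeis.closure_range_gen ha hb,
      Subgroup.closure_le, ← hcomp]
    rintro _ ⟨i, rfl⟩
    exact ⟨_, rfl⟩
  let e := MulEquiv.ofBijective φ ⟨hinj, hsurj⟩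
  refine ⟨(SignedHeis.interCond_gen ha hb).of_comp_injective hinj hcomp, ?_, ?_, ?_, ?_, ?_⟩
  · rw [← orderOf_injective φ hinj, map_mul, hφ, hφ, SignedHeis.orderOf_gen_zero_mul_gen_one]
  · rw [← orderOf_injective φ hinj, map_mul, hφ, hφ, SignedHeis.orderOf_gen_one_mul_gen_two]
  · rw [← orderOf_injective φ hinj, map_mul, hφ, hφ, SignedHeis.orderOf_gen_two_mul_gen_three]
  · rw [Nat.card_congr e.toEquiv, SignedHeis.natCard]
  · rw [← Subgroup.index_map_equiv _ e]
    have he : (e : Gamma 4 P →* SignedHeis f g) = φ := MonoidHom.ext fun _ => rfl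
    rw [he, MonoidHom.map_closure]
    simp only [Set.image_insert_eq, Set.image_singleton, map_mul, hφ]
    exact SignedHeis.index_rotation
end
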